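/- Let D be a finite digraph without useless arcs for r ∈ V(D), and let T be a 1-optimal out-branching of D rooted at r with |Leaf(T)| ≤ k−1. Then either D has an out-branching with at least k leaves, or the underlying undirected graph of D admits a path decomposition of width at most 6k³. -/

import Mathlib

/-- A (finite) digraph: a finite vertex set together with a finite set of arcs. -/
structure Dgraph (V : Type*) where
  verts : Finset V
  arcs : Finset (V × V)

variable {V : Type*} [DecidableEq V]

/-- All arcs have both endpoints among the vertices. -/
def DgraphWF (D : Dgraph V) : Prop := ∀ a ∈ D.arcs, a.1 ∈ D.verts ∧ a.2 ∈ D.verts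

/-- `v` is reachable from `u` by a dipath in `D`. -/
def Dgraph.Reaches (D : Dgraph V) (u v : V) : Prop :=
  Relation.ReflTransGen (fun a b => (a, b) ∈ D.arcs) u v

def inDeg (D : Dgraph V) (v : V) : ℕ := (D.arcs.filter (fun a => a.2 = v)).card

def outDeg (D : Dgraph V) (v : V) : ℕ := (D.arcs.filter (fun a => a.1 = v)).card

/-- `T` is an out-tree with root `r`: exactly one vertex (the root) of in-degree 0,
all other vertices of in-degree 1, and (equivalently to being connected and acyclic
as an undirected graph) every vertex is reachable from the root. -/
def IsOutTree (T : Dgraph V) (r : V) : Prop :=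
  (∀ a ∈ T.arcs, a.1 ∈ T.verts ∧ a.2 ∈ T.verts) ∧
  r ∈ T.verts ∧ inDeg T r = 0 ∧
  (∀ v ∈ T.verts, v ≠ r → inDeg T v = 1) ∧
  (∀ v ∈ T.verts, T.Reaches r v)

def IsSubgraph (T D : Dgraph V) : Prop := T.verts ⊆ D.verts ∧ T.arcs ⊆ D.arcs

/-- `T` is an out-branching (a spanning out-tree) of `D` with root `r`. -/
def IsOutBranching (D T : Dgraph V) (r : V) : Prop :=
  IsSubgraph T D ∧ T.verts = D.verts ∧ IsOutTree T r

/-- The set of leaves (vertices of out-degree 0). -/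
def leaves (T : Dgraph V) : Finset V := T.verts.filter (fun v => outDeg T v = 0)

/-- Vertices whose in-neighbor is a branch vertex (a vertex of out-degree at least 2). -/
def brSucc (T : Dgraph V) : Finset V :=
  T.verts.filter (fun v => ∃ a ∈ T.arcs, a.2 = v ∧ 2 ≤ outDeg T a.1)

/-- The 1-change for arc `(u,v)`, where `w` is the in-neighbor of `v` in `T`:
`T + (u,v) - (w,v)`. -/
def oneChange (T : Dgraph V) (u v w : V) : Dgraph V :=
  ⟨T.verts, insert (u, v) (T.arcs.erase (w, v))⟩

/-- `T` is a 1-optimal out-branching of `D` rooted at `r`: no 1-change for an arc of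
`A(D) \ A(T)` results in an out-branching with more leaves. -/
def OneOptimal (D T : Dgraph V) (r : V) : Prop :=
  ∀ u v w, (u, v) ∈ D.arcs → (u, v) ∉ T.arcs → v ≠ r → (w, v) ∈ T.arcs →
    ∀ r', IsOutBranching D (oneChange T u v w) r' →
      (leaves (oneChange T u v w)).card ≤ (leaves T).card

/-- The list of vertices `p` forms a dipath in `D`. -/
def IsDipath (D : Dgraph V) (p : List V) : Prop :=
  p.Nodup ∧ (∀ x ∈ p, x ∈ D.verts) ∧ p.Chain' (fun a b => (a, b) ∈ D.arcs)

/-- Delete a vertex and all incident arcs. -/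
def delVert (D : Dgraph V) (v : V) : Dgraph V :=
  ⟨D.verts.erase v, D.arcs.filter (fun a => a.1 ≠ v ∧ a.2 ≠ v)⟩

open Classical in
/-- `HB_D^T(z,l)`: the heads of arcs `(u,v)` of `D` with `v ≺_T z ⪯_T u ⪯_T l`,
minus `BrSucc(T)`. -/
noncomputable def HBset (D T : Dgraph V) (z l : V) : Finset V :=
  ((D.arcs.filter (fun a =>
      (T.Reaches a.2 z ∧ a.2 ≠ z) ∧ T.Reaches z a.1 ∧ T.Reaches a.1 l)).image Prod.snd)
    \ brSucc T

/-- The consecutive pairs of a list, cyclically (with wraparound). -/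
def cycPairs (c : List V) : List (V × V) := c.zip (c.rotate 1)

open Relation in
/-- A path from inside `P` to outside `P` has a last arc leaving `P`. -/
theorem exists_last_exit {α : Type*} {R : α → α → Prop} {P : α → Prop} {a b : α}
    (h : ReflTransGen R a b) (ha : P a) (hb : ¬ P b) :
    ∃ x s, P x ∧ ¬ P s ∧ R x s ∧
      ReflTransGen (fun c d => R c d ∧ ¬ P c ∧ ¬ P d) s b := by
  induction h with
  | refl => exact absurd ha hb
  | @tail c d _ hcd ih =>
    by_cases hc : P c
    · exact ⟨c, d, hc, hb, hcd, .refl⟩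
    · obtain ⟨x, s, hx, hs, hxs, hsc⟩ := ih hc
      exact ⟨x, s, hx, hs, hxs, hsc.tail ⟨hcd, hc, hb⟩⟩

open Relation in
/-- A path may be transported to another relation arc by arc, using that every arc of the path
lies between its two ends. -/
theorem reflTransGen_mono_between {α : Type*} {R R' : α → α → Prop} {a b : α}
    (h : ReflTransGen R a b)
    (H : ∀ c d, ReflTransGen R a c → R c d → ReflTransGen R d b → R' c d) :
    ReflTransGen R' a b := by
  induction h with
  | refl => exact .refl
  | @tail c d hac hcd ih =>
    exact (ih fun e f hae hef hfc => H e f hae hef (hfc.tail hcd)).tail (H c d hac hcd .refl)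

open Relation in
/-- Every vertex reachable from `r` can be given a predecessor so that following these
predecessors leads back to `r`. -/
theorem exists_predecessor {α : Type*} (R : α → α → Prop) (r : α) :
    ∃ (par : α → α) (rank : α → ℕ), ∀ v, ReflTransGen R r v → v ≠ r →
      R (par v) v ∧ ReflTransGen R r (par v) ∧ rank (par v) < rank v := by
  let layer : ℕ → α → Prop := fun n => Nat.rec (fun v => v = r)
    (fun _ S v => ∃ u, S u ∧ R u v) n
  have hex : ∀ v, ReflTransGen R r v → ∃ n, layer n v := by
    intro v hv
    induction hv with
    | refl => exact ⟨0, rfl⟩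
    | @tail c d _ hcd ih =>
      obtain ⟨n, hn⟩ := ih
      exact ⟨n + 1, c, hn, hcd⟩
  have hlayer : ∀ n v, layer n v → ReflTransGen R r v := by
    intro n
    induction n with
    | zero => intro v hv; change v = r at hv; subst hv; exact .refl
    | succ n ih =>
      rintro v ⟨u, hu, huv⟩
      exact (ih u hu).tail huv
  let rank : α → ℕ := fun v => sInf {n | layer n v}
  have key : ∀ v, ∃ u, ReflTransGen R r v → v ≠ r →
      R u v ∧ ReflTransGen R r u ∧ rank u < rank v := by
    intro v
    by_cases hv : ReflTransGen R r v ∧ v ≠ r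
    · obtain ⟨hv, hne⟩ := hv
      have hspec : layer (rank v) v := Nat.sInf_mem (hex v hv)
      cases hn : rank v with
      | zero =>
        rw [hn] at hspec
        exact absurd hspec hne
      | succ n =>
        rw [hn] at hspec
        obtain ⟨u, hu, huv⟩ := hspec
        exact ⟨u, fun _ _ => ⟨huv, hlayer _ _ hu, Nat.lt_succ_of_le (Nat.sInf_le hu)⟩⟩
    · exact ⟨v, fun h1 h2 => absurd ⟨h1, h2⟩ hv⟩
  choose par hpar using key
  exact ⟨par, rank, hpar⟩

namespace IsOutTree

variable {T : Dgraph V} {r : V}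

theorem parent_unique (hT : IsOutTree T r) {a b v : V} (ha : (a, v) ∈ T.arcs)
    (hb : (b, v) ∈ T.arcs) : a = b := by
  obtain ⟨hwf, -, h0, h1, -⟩ := hT
  have hle : inDeg T v ≤ 1 := by
    by_cases hv : v = r
    · subst hv; omega
    · exact (h1 v (hwf _ ha).2 hv).le
  have := Finset.card_le_one.1 hle (a, v) (by simp [ha]) (b, v) (by simp [hb])
  exact congrArg Prod.fst this

theorem not_arc_root (hT : IsOutTree T r) (a : V) : (a, r) ∉ T.arcs := by
  intro ha
  have h0 := Finset.card_eq_zero.1 hT.2.2.1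
  have : (a, r) ∈ T.arcs.filter (fun a => a.2 = r) := by simp [ha]
  rw [h0] at this
  simp at this

/-- A digraph with unique parents, no arc into `r` and everything reachable from `r` is an
out-tree. -/
theorem of_parents (hwf : ∀ a ∈ T.arcs, a.1 ∈ T.verts ∧ a.2 ∈ T.verts) (hr : r ∈ T.verts)
    (hroot : ∀ a, (a, r) ∉ T.arcs)
    (huniq : ∀ a b v, (a, v) ∈ T.arcs → (b, v) ∈ T.arcs → a = b)
    (hreach : ∀ v ∈ T.verts, T.Reaches r v) : IsOutTree T r := by
  refine ⟨hwf, hr, ?_, ?_, hreach⟩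
  · refine Finset.card_eq_zero.2 (Finset.filter_eq_empty_iff.2 ?_)
    rintro ⟨a, b⟩ hab rfl
    exact hroot a hab
  · intro v hv hne
    refine le_antisymm ?_ ?_
    · refine Finset.card_le_one.2 ?_
      rintro ⟨a, a'⟩ ha ⟨b, b'⟩ hb
      simp only [Finset.mem_filter] at ha hb
      obtain ⟨ha, rfl⟩ := ha
      obtain ⟨hb, rfl⟩ := hb
      rw [huniq _ _ _ ha hb]
    · obtain h | ⟨c, -, hc⟩ := Relation.ReflTransGen.cases_tail (hreach v hv)
      · exact absurd h hne
      · exact Finset.card_pos.2 ⟨(c, v), by simp [hc]⟩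

theorem not_transGen_self (hT : IsOutTree T r) {v : V} (hv : v ∈ T.verts) :
    ¬ Relation.TransGen (fun a b => (a, b) ∈ T.arcs) v v := by
  induction hT.2.2.2.2 v hv with
  | refl =>
    intro h
    obtain ⟨c, -, hc⟩ := Relation.TransGen.tail'_iff.1 h
    exact hT.not_arc_root c hc
  | @tail y x _ hyx ih =>
    intro h
    obtain ⟨c, hxc, hc⟩ := Relation.TransGen.tail'_iff.1 h
    obtain rfl := hT.parent_unique hc hyx
    exact ih (hT.1 _ hyx).1 (Relation.TransGen.head' hyx hxc)

theorem mem_left (hT : IsOutTree T r) {a b : V} (h : T.Reaches a b) (hb : b ∈ T.verts) :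
    a ∈ T.verts := by
  obtain rfl | ⟨c, hc, -⟩ := Relation.ReflTransGen.cases_head h
  · exact hb
  · exact (hT.1 _ hc).1

theorem mem_right (hT : IsOutTree T r) {a b : V} (h : T.Reaches a b) (ha : a ∈ T.verts) :
    b ∈ T.verts := by
  obtain rfl | ⟨c, -, hc⟩ := Relation.ReflTransGen.cases_tail h
  · exact ha
  · exact (hT.1 _ hc).2

theorem reaches_antisymm (hT : IsOutTree T r) {a b : V} (hab : T.Reaches a b)
    (hba : T.Reaches b a) : a = b := by
  obtain h | ⟨c, hc, hcb⟩ := Relation.ReflTransGen.cases_head hab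
  · exact h
  · exact absurd (Relation.TransGen.head' hc (hcb.trans hba)) (hT.not_transGen_self (hT.1 _ hc).1)

theorem reaches_total (hT : IsOutTree T r) {a b v : V} (ha : T.Reaches a v)
    (hb : T.Reaches b v) : T.Reaches a b ∨ T.Reaches b a := by
  have hU : Relator.RightUnique (Function.swap fun a b => (a, b) ∈ T.arcs) :=
    fun x y z hxy hxz => hT.parent_unique hxy hxz
  have := Relation.ReflTransGen.total_of_right_unique hU
    (Relation.reflTransGen_swap.2 ha) (Relation.reflTransGen_swap.2 hb)
  exact this.symm.imp Relation.reflTransGen_swap.1 Relation.reflTransGen_swap.1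

end IsOutTree

open Classical in
/-- The number of ancestors of `v` in `T`, including `v` itself. -/
noncomputable def Dgraph.depth (T : Dgraph V) (v : V) : ℕ :=
  (T.verts.filter fun x => T.Reaches x v).card

namespace IsOutTree

variable {T : Dgraph V} {r : V}

theorem one_le_depth {V : Type*} {T : Dgraph V} {v : V} (hv : v ∈ T.verts) : 1 ≤ T.depth v :=
  by
  classical exact Finset.card_pos.2 ⟨v, Finset.mem_filter.2 ⟨hv, .refl⟩⟩

theorem depth_le {V : Type*} (T : Dgraph V) (v : V) : T.depth v ≤ T.verts.card := by
  classical exact Finset.card_le_card (Finset.filter_subset _ _)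

theorem depth_mono {V : Type*} {T : Dgraph V} {a b : V} (h : T.Reaches a b) :
    T.depth a ≤ T.depth b := by
  refine Finset.card_le_card fun x hx => ?_
  simp only [Finset.mem_filter] at hx ⊢
  exact ⟨hx.1, hx.2.trans h⟩

theorem depth_lt (hT : IsOutTree T r) {a b : V} (hb : b ∈ T.verts) (h : T.Reaches a b)
    (hne : a ≠ b) : T.depth a < T.depth b := by
  refine Finset.card_lt_card ((Finset.ssubset_iff_of_subset fun x hx => ?_).2 ⟨b, ?_, ?_⟩)
  · simp only [Finset.mem_filter] at hx ⊢
    exact ⟨hx.1, hx.2.trans h⟩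
  · simp only [Finset.mem_filter]
    exact ⟨hb, .refl⟩
  · simp only [Finset.mem_filter, not_and]
    exact fun _ hba => hne (hT.reaches_antisymm h hba)

theorem depth_root (hT : IsOutTree T r) : T.depth r = 1 := by
  refine Finset.card_eq_one.2 ⟨r, ?_⟩
  ext x
  simp only [Finset.mem_filter, Finset.mem_singleton]
  refine ⟨fun ⟨hx, hxr⟩ => hT.reaches_antisymm hxr (hT.2.2.2.2 x hx), ?_⟩
  rintro rfl
  exact ⟨hT.2.1, .refl⟩

theorem depth_child (hT : IsOutTree T r) {a b : V} (h : (a, b) ∈ T.arcs) :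
    T.depth b = T.depth a + 1 := by
  classical
  have hnot : b ∉ T.verts.filter fun x => T.Reaches x a := by
    simp only [Finset.mem_filter, not_and]
    exact fun hb hba => hT.not_transGen_self hb (Relation.TransGen.tail' hba h)
  have : (T.verts.filter fun x => T.Reaches x b) =
      insert b (T.verts.filter fun x => T.Reaches x a) := by
    ext x
    simp only [Finset.mem_filter, Finset.mem_insert]
    constructor
    · rintro ⟨hx, hxb⟩
      obtain h' | ⟨c, hxc, hcb⟩ := Relation.ReflTransGen.cases_tail hxb
      · exact .inl h'.symm
      · obtain rfl := hT.parent_unique hcb h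
        exact .inr ⟨hx, hxc⟩
    · rintro (rfl | ⟨hx, hxa⟩)
      · exact ⟨(hT.1 _ h).2, .refl⟩
      · exact ⟨hx, hxa.tail h⟩
  have hcard := Finset.card_insert_of_notMem hnot
  rw [← this] at hcard
  unfold Dgraph.depth
  convert hcard

theorem exists_ancestor_depth_eq (hT : IsOutTree T r) {u : V} (hu : u ∈ T.verts) {j : ℕ}
    (hj : 1 ≤ j) (hju : j ≤ T.depth u) : ∃ z ∈ T.verts, T.Reaches z u ∧ T.depth z = j := by
  induction hT.2.2.2.2 u hu with
  | refl =>
    have := hT.depth_root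
    exact ⟨r, hT.2.1, .refl, by omega⟩
  | @tail y x _ hyx ih =>
    have hd := hT.depth_child hyx
    by_cases h : j = T.depth x
    · exact ⟨x, hu, .refl, h.symm⟩
    · obtain ⟨z, hz, hzy, hzj⟩ := ih (hT.1 _ hyx).1 (by omega)
      exact ⟨z, hz, hzy.tail hyx, hzj⟩

theorem exists_leaf (hT : IsOutTree T r) {v : V} (hv : v ∈ T.verts) :
    ∃ l ∈ leaves T, T.Reaches v l := by
  classical
  obtain ⟨l, hl, hmax⟩ := Finset.exists_max_image (T.verts.filter fun x => T.Reaches v x) T.depth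
    ⟨v, Finset.mem_filter.2 ⟨hv, .refl⟩⟩
  simp only [Finset.mem_filter] at hl hmax
  refine ⟨l, ?_, hl.2⟩
  refine Finset.mem_filter.2 ⟨hl.1, Finset.card_eq_zero.2 (Finset.filter_eq_empty_iff.2 ?_)⟩
  rintro ⟨a, b⟩ hab rfl
  have h1 := hmax b ⟨(hT.1 _ hab).2, hl.2.tail hab⟩
  have h2 := hT.depth_child hab
  simp only at h1
  omega

/-- An antichain of an out-tree has at most as many elements as there are leaves. -/
theorem card_antichain_le (hT : IsOutTree T r) {F : Finset V} (hF : F ⊆ T.verts)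
    (hanti : ∀ a ∈ F, ∀ b ∈ F, T.Reaches a b → a = b) : F.card ≤ (leaves T).card := by
  have : ∀ v, ∃ l, v ∈ F → l ∈ leaves T ∧ T.Reaches v l := fun v => by
    by_cases hv : v ∈ F
    · obtain ⟨l, hl⟩ := hT.exists_leaf (hF hv)
      exact ⟨l, fun _ => hl⟩
    · exact ⟨v, fun h => absurd h hv⟩
  choose f hf using this
  refine Finset.card_le_card_of_injOn f (fun v hv => (hf v hv).1) ?_
  intro a ha b hb hab
  obtain h | h := hT.reaches_total (hf a ha).2 (hab ▸ (hf b hb).2)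
  · exact hanti a ha b hb h
  · exact (hanti b hb a ha h).symm

theorem card_arcs_le (hT : IsOutTree T r) : T.arcs.card ≤ T.verts.card := by
  refine Finset.card_le_card_of_injOn Prod.snd (fun a ha => (hT.1 a ha).2) ?_
  rintro ⟨a, v⟩ ha ⟨b, w⟩ hb h
  obtain rfl : v = w := h
  rw [hT.parent_unique ha hb]

theorem card_brSucc_le (hT : IsOutTree T r) : (brSucc T).card ≤ 2 * (leaves T).card := by
  have h1 : (brSucc T).card ≤ (T.arcs.filter fun a => 2 ≤ outDeg T a.1).card := by
    refine (Finset.card_le_card fun v hv => ?_).trans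
      (Finset.card_image_le (s := T.arcs.filter fun a => 2 ≤ outDeg T a.1) (f := Prod.snd))
    obtain ⟨-, a, ha, rfl, h2⟩ := Finset.mem_filter.1 hv
    exact Finset.mem_image_of_mem _ (Finset.mem_filter.2 ⟨ha, h2⟩)
  have h2 : (T.arcs.filter fun a => 2 ≤ outDeg T a.1).card =
      ∑ v ∈ T.verts, if 2 ≤ outDeg T v then outDeg T v else 0 := by
    rw [Finset.card_eq_sum_card_fiberwise (f := Prod.fst) (t := T.verts)
      (fun a ha => (hT.1 a (Finset.mem_filter.1 ha).1).1)]
    refine Finset.sum_congr rfl fun v _ => ?_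
    rw [Finset.filter_filter]
    split_ifs with h
    · unfold outDeg
      congr 1
      refine Finset.filter_congr fun a _ => ⟨fun h' => h'.2, ?_⟩
      rintro rfl
      exact ⟨h, rfl⟩
    · refine Finset.card_eq_zero.2 (Finset.filter_eq_empty_iff.2 ?_)
      rintro a - ⟨h', rfl⟩
      exact h h'
  have h3 : T.arcs.card = ∑ v ∈ T.verts, outDeg T v :=
    Finset.card_eq_sum_card_fiberwise (f := Prod.fst) (t := T.verts) (fun a ha => (hT.1 a ha).1)
  have h4 : (leaves T).card = ∑ v ∈ T.verts, if outDeg T v = 0 then 1 else 0 :=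
    Finset.card_filter _ _
  have h5 : ∑ v ∈ T.verts, ((if 2 ≤ outDeg T v then outDeg T v else 0) + 2) ≤
      ∑ v ∈ T.verts, (2 * outDeg T v + 2 * if outDeg T v = 0 then 1 else 0) := by
    refine Finset.sum_le_sum fun v _ => ?_
    split_ifs <;> omega
  rw [Finset.sum_add_distrib, Finset.sum_add_distrib, ← Finset.mul_sum, ← Finset.mul_sum,
    ← h2, ← h3, ← h4, Finset.sum_const, smul_eq_mul] at h5
  have := hT.card_arcs_le
  omega

theorem mem_brSucc (hT : IsOutTree T r) {a b c : V} (hb : (a, b) ∈ T.arcs)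
    (hc : (a, c) ∈ T.arcs) (hne : b ≠ c) : b ∈ brSucc T := by
  refine Finset.mem_filter.2 ⟨(hT.1 _ hb).2, (a, b), hb, rfl, ?_⟩
  exact Finset.one_lt_card.2 ⟨(a, b), by simp [hb], (a, c), by simp [hc], by simpa using hne⟩

end IsOutTree

theorem outDeg_ne_zero {T : Dgraph V} {a b : V} (h : (a, b) ∈ T.arcs) : outDeg T a ≠ 0 :=
  Finset.card_ne_zero.2 ⟨(a, b), by simp [h]⟩

/-- The 1-change for a non-backward arc is again an out-branching. -/
theorem IsOutBranching.oneChange {D T : Dgraph V} {r u v w : V} (hT : IsOutBranching D T r)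
    (hwf : DgraphWF D) (huv : (u, v) ∈ D.arcs) (hvr : v ≠ r) (hw : (w, v) ∈ T.arcs)
    (hback : ¬ T.Reaches v u) : IsOutBranching D (oneChange T u v w) r := by
  obtain ⟨⟨hsv, hsa⟩, hverts, hT⟩ := hT
  have hmem : ∀ {a b}, (a, b) ∈ T.arcs → b ≠ v → (a, b) ∈ (_root_.oneChange T u v w).arcs := by
    intro a b hab hb
    refine Finset.mem_insert_of_mem (Finset.mem_erase.2 ⟨?_, hab⟩)
    rintro ⟨⟩
    exact hb rfl
  have hcases : ∀ {a b}, (a, b) ∈ (_root_.oneChange T u v w).arcs →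
      (a = u ∧ b = v) ∨ ((a, b) ∈ T.arcs ∧ b ≠ v) := by
    intro a b hab
    obtain h | h := Finset.mem_insert.1 hab
    · exact .inl (Prod.mk.inj h)
    · obtain ⟨hne, habT⟩ := Finset.mem_erase.1 h
      refine .inr ⟨habT, ?_⟩
      rintro rfl
      exact hne (by rw [hT.parent_unique habT hw])
  have hpre : ∀ x, T.Reaches r x → ¬ T.Reaches v x →
      (_root_.oneChange T u v w).Reaches r x := by
    intro x hx
    induction hx with
    | refl => exact fun _ => .refl
    | @tail y x _ hyx ih =>
      intro hvx
      refine (ih fun h => hvx (h.tail hyx)).tail (hmem hyx ?_)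
      rintro rfl
      exact hvx .refl
  have huD := hwf _ huv
  have hru : (_root_.oneChange T u v w).Reaches r u :=
    hpre u (hT.2.2.2.2 u (hverts ▸ huD.1)) hback
  have hrv : (_root_.oneChange T u v w).Reaches r v := hru.tail (Finset.mem_insert_self _ _)
  refine ⟨⟨hsv, ?_⟩, hverts, IsOutTree.of_parents ?_ hT.2.1 ?_ ?_ ?_⟩
  · rintro ⟨a, b⟩ hab
    obtain ⟨rfl, rfl⟩ | ⟨h, -⟩ := hcases hab
    · exact huv
    · exact hsa h
  · rintro ⟨a, b⟩ hab
    obtain ⟨rfl, rfl⟩ | ⟨h, -⟩ := hcases hab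
    · change _ ∈ T.verts ∧ _ ∈ T.verts
      rwa [hverts]
    · exact hT.1 _ h
  · intro a ha
    obtain ⟨-, h⟩ | ⟨h, -⟩ := hcases ha
    · exact hvr h.symm
    · exact hT.not_arc_root a h
  · intro a b x ha hb
    obtain ⟨rfl, h⟩ | ⟨h, hx⟩ := hcases ha <;> obtain ⟨rfl, h'⟩ | ⟨h', hx'⟩ := hcases hb
    · rfl
    · exact absurd h hx'
    · exact absurd h' hx
    · exact hT.parent_unique h h'
  · intro x hx
    induction hT.2.2.2.2 x hx with
    | refl => exact .refl
    | @tail y x _ hyx ih =>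
      by_cases hxv : x = v
      · rwa [hxv]
      · exact (ih (hT.1 _ hyx).1).tail (hmem hyx hxv)

/-- With respect to a 1-optimal out-branching, every other arc goes backward, leaves a leaf, or
enters a child of a branch vertex. -/
theorem OneOptimal.arc_cases {D T : Dgraph V} {r : V} (hopt : OneOptimal D T r)
    (hwf : DgraphWF D) (hT : IsOutBranching D T r) {u v : V} (huv : (u, v) ∈ D.arcs)
    (hnot : (u, v) ∉ T.arcs) : T.Reaches v u ∨ u ∈ leaves T ∨ v ∈ brSucc T := by
  have hOT := hT.2.2
  have huD := hwf _ huv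
  rw [← hT.2.1] at huD
  by_contra! hcon
  obtain ⟨hback, hleaf, hbr⟩ := hcon
  have hvr : v ≠ r := by
    rintro rfl
    exact hback (hOT.2.2.2.2 u huD.1)
  obtain h | ⟨w, -, hw⟩ := Relation.ReflTransGen.cases_tail (hOT.2.2.2.2 v huD.2)
  · exact hvr h
  have hle := hopt u v w huv hnot hvr hw r (hT.oneChange hwf huv hvr hw hback)
  have hwu : w ≠ u := by
    rintro rfl
    exact hnot hw
  have hwleaf : w ∉ leaves T := fun h => outDeg_ne_zero hw (Finset.mem_filter.1 h).2
  have hsub : insert w (leaves T) ⊆ leaves (oneChange T u v w) := by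
    intro x hx
    have hx' : x ∈ T.verts ∧ x ≠ u ∧ ∀ b, (x, b) ∈ T.arcs → (x, b) = (w, v) := by
      obtain rfl | hx := Finset.mem_insert.1 hx
      · refine ⟨(hOT.1 _ hw).1, hwu, fun b hb => ?_⟩
        by_contra hne
        exact hbr (hOT.mem_brSucc hw hb fun h => hne (by rw [h]))
      · refine ⟨(Finset.mem_filter.1 hx).1, ?_, fun b hb => ?_⟩
        · rintro rfl
          exact hleaf hx
        · exact absurd (Finset.mem_filter.1 hx).2 (outDeg_ne_zero hb)
    refine Finset.mem_filter.2 ⟨hx'.1, Finset.card_eq_zero.2 (Finset.filter_eq_empty_iff.2 ?_)⟩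
    rintro ⟨a, b⟩ hab rfl
    obtain h | h := Finset.mem_insert.1 hab
    · exact hx'.2.1 (Prod.mk.inj h).1
    · obtain ⟨hne, h⟩ := Finset.mem_erase.1 h
      exact hne (hx'.2.2 b h)
  have := Finset.card_le_card hsub
  rw [Finset.card_insert_of_notMem hwleaf] at this
  omega

/-- If every vertex of `F` is reachable from `r` by a dipath with no earlier vertex in `F`, then
some out-branching has at least `F.card` leaves. -/
theorem exists_outBranching_card_le_leaves {D : Dgraph V} {r : V} (hwf : DgraphWF D)
    (hr : r ∈ D.verts) (hreach : ∀ x ∈ D.verts, D.Reaches r x) {F : Finset V}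
    (hF : F ⊆ D.verts)
    (hFreach : ∀ f ∈ F, Relation.ReflTransGen (fun a b => (a, b) ∈ D.arcs ∧ a ∉ F) r f) :
    ∃ T, IsOutBranching D T r ∧ F.card ≤ (leaves T).card := by
  classical
  obtain ⟨p, rk, hp⟩ := exists_predecessor (fun a b => (a, b) ∈ D.arcs) r
  obtain ⟨q, rk', hq⟩ := exists_predecessor (fun a b => (a, b) ∈ D.arcs ∧ a ∉ F) r
  set N : V → Prop := Relation.ReflTransGen (fun a b => (a, b) ∈ D.arcs ∧ a ∉ F) r
  let par : V → V := fun v => if N v then q v else p v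
  have hpar : ∀ v ∈ D.verts, v ≠ r → (par v, v) ∈ D.arcs := by
    intro v hv hne
    by_cases h : N v
    · simpa only [par, if_pos h] using (hq v h hne).1.1
    · simpa only [par, if_neg h] using (hp v (hreach v hv) hne).1
  let T : Dgraph V := ⟨D.verts, (D.verts.erase r).image fun v => (par v, v)⟩
  have harc : ∀ a b, (a, b) ∈ T.arcs ↔ (b ∈ D.verts ∧ b ≠ r) ∧ a = par b := by
    intro a b
    simp only [T, Finset.mem_image, Finset.mem_erase, Prod.mk.injEq]
    constructor
    · rintro ⟨v, ⟨h1, h2⟩, rfl, rfl⟩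
      exact ⟨⟨h2, h1⟩, rfl⟩
    · rintro ⟨⟨h2, h1⟩, rfl⟩
      exact ⟨b, ⟨h1, h2⟩, rfl, rfl⟩
  have hsub : T.arcs ⊆ D.arcs := by
    rintro ⟨a, b⟩ hab
    obtain ⟨⟨hb, hbr⟩, rfl⟩ := (harc a b).1 hab
    exact hpar b hb hbr
  have hreachN : ∀ n v, rk' v = n → v ∈ D.verts → N v → T.Reaches r v := by
    intro n
    induction n using Nat.strong_induction_on with
    | _ n ih =>
      rintro v rfl hv hNv
      by_cases hvr : v = r
      · subst hvr; exact .refl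
      · obtain ⟨h1, h2, h3⟩ := hq v hNv hvr
        have : par v = q v := if_pos hNv
        exact (ih _ h3 (q v) rfl (hwf _ h1.1).1 h2).tail ((harc _ _).2 ⟨⟨hv, hvr⟩, this.symm⟩)
  have hreachT : ∀ n v, rk v = n → v ∈ D.verts → T.Reaches r v := by
    intro n
    induction n using Nat.strong_induction_on with
    | _ n ih =>
      rintro v rfl hv
      by_cases hNv : N v
      · exact hreachN _ v rfl hv hNv
      by_cases hvr : v = r
      · subst hvr; exact .refl
      · obtain ⟨h1, -, h3⟩ := hp v (hreach v hv) hvr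
        have : par v = p v := if_neg hNv
        exact (ih _ h3 (p v) rfl (hwf _ h1).1).tail ((harc _ _).2 ⟨⟨hv, hvr⟩, this.symm⟩)
  have hOT : IsOutTree T r := by
    refine IsOutTree.of_parents (fun a ha => hwf a (hsub ha)) hr ?_ ?_
      (fun v hv => hreachT _ v rfl hv)
    · exact fun a ha => ((harc a r).1 ha).1.2 rfl
    · exact fun a b v ha hb => ((harc a v).1 ha).2.trans ((harc b v).1 hb).2.symm
  refine ⟨T, ⟨⟨subset_rfl, hsub⟩, rfl, hOT⟩, hOT.card_antichain_le hF ?_⟩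
  have hup : ∀ a b, T.Reaches a b → N b → N a := by
    intro a b hab hNb
    induction hab using Relation.ReflTransGen.head_induction_on with
    | refl => exact hNb
    | @head a c hac _ ih =>
      obtain ⟨⟨-, hcr⟩, rfl⟩ := (harc a c).1 hac
      have : par c = q c := if_pos ih
      rw [this]
      exact (hq c ih hcr).2.1
  intro a ha b hb hab
  obtain h | ⟨c, hac, hcb⟩ := Relation.ReflTransGen.cases_head hab
  · exact h
  · have hNc := hup c b hcb (hFreach b hb)
    obtain ⟨⟨-, hcr⟩, rfl⟩ := (harc a c).1 hac
    have : par c = q c := if_pos hNc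
    rw [this] at ha
    exact absurd ha (hq c hNc hcr).1.2

open Classical in
/-- The heads of the arcs of `D` that jump backward over the tree vertex `z`. -/
noncomputable def backHeads (D T : Dgraph V) (z : V) : Finset V :=
  D.verts.filter fun v => T.Reaches v z ∧ v ≠ z ∧ ∃ u, (u, v) ∈ D.arcs ∧ T.Reaches z u

/-- The arcs of `D` having no end among the `T`-ancestors of `v`. -/
def avoidAnc (D T : Dgraph V) (v a b : V) : Prop :=
  (a, b) ∈ D.arcs ∧ ¬ T.Reaches a v ∧ ¬ T.Reaches b v

/-- A backward arc `(u, v)` that is not useless gives a way around `v`: it departs from the tree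
path to `v` into a child of a branch vertex and never touches that tree path again. -/
theorem exists_detour {D T : Dgraph V} {r : V} (hwf : DgraphWF D)
    (hnouseless : ∀ a ∈ D.arcs, ∃ T' : Dgraph V, IsOutBranching D T' r ∧ a ∈ T'.arcs)
    (hT : IsOutBranching D T r) (hopt : OneOptimal D T r) {u v : V} (huv : (u, v) ∈ D.arcs)
    (hvu : T.Reaches v u) (hne : v ≠ u) :
    ∃ x s, T.Reaches x v ∧ x ≠ v ∧ s ∈ brSucc T ∧ (x, s) ∈ D.arcs ∧ ¬ T.Reaches s v ∧
      Relation.ReflTransGen (avoidAnc D T v) s u := by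
  have hOT := hT.2.2
  obtain ⟨T', hT', hmem⟩ := hnouseless _ huv
  have hOT' := hT'.2.2
  have huv' := hOT'.1 _ hmem
  have hrv : T.Reaches r v := hOT.2.2.2.2 v (by rw [hT.2.1]; exact (hwf _ huv).2)
  obtain ⟨x, s, hx, hs, hxs, hsu⟩ := exists_last_exit (P := fun y => T.Reaches y v)
    (hOT'.2.2.2.2 u huv'.1) hrv (fun h => hne (hOT.reaches_antisymm hvu h))
  have hxD : (x, s) ∈ D.arcs := hT'.1.2 hxs
  have hxv : x ≠ v := by
    rintro rfl
    have hsu' : T'.Reaches s u := reflTransGen_mono_between hsu fun _ _ _ h _ => h.1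
    exact hOT'.not_transGen_self huv'.2 (Relation.TransGen.tail' (hsu'.head hxs) hmem)
  obtain h | ⟨c, hxc, hcv⟩ := Relation.ReflTransGen.cases_head hx
  · exact absurd h hxv
  refine ⟨x, s, hx, hxv, ?_, hxD, hs,
    reflTransGen_mono_between hsu fun _ _ _ h _ => ⟨hT'.1.2 h.1, h.2⟩⟩
  by_cases hxsT : (x, s) ∈ T.arcs
  · refine hOT.mem_brSucc hxsT hxc ?_
    rintro rfl
    exact hs hcv
  · obtain h | h | h := hopt.arc_cases hwf hT hxD hxsT
    · exact absurd (h.trans hx) hs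
    · exact absurd (Finset.mem_filter.1 h).2 (outDeg_ne_zero hxc)
    · exact h

/-- If every out-branching has at most `n` leaves, few heads of backward arcs jump over a given
tree vertex. -/
theorem card_backHeads_le {D T : Dgraph V} {r : V} {n : ℕ} (hwf : DgraphWF D)
    (hr : r ∈ D.verts) (hreach : ∀ x ∈ D.verts, D.Reaches r x)
    (hnouseless : ∀ a ∈ D.arcs, ∃ T' : Dgraph V, IsOutBranching D T' r ∧ a ∈ T'.arcs)
    (hT : IsOutBranching D T r) (hopt : OneOptimal D T r)
    (hn : ∀ T', IsOutBranching D T' r → (leaves T').card ≤ n) (z : V) :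
    (backHeads D T z).card ≤ (brSucc T).card * (2 * n) := by
  classical
  have hOT := hT.2.2
  have hTD : ∀ {a b}, (a, b) ∈ T.arcs → (a, b) ∈ D.arcs := fun h => hT.1.2 h
  have hbh : ∀ v, v ∈ backHeads D T z ↔ v ∈ D.verts ∧ T.Reaches v z ∧ v ≠ z ∧
      ∃ u, (u, v) ∈ D.arcs ∧ T.Reaches z u := fun v => by simp [backHeads]
  have hdet : ∀ v, ∃ u x s, v ∈ backHeads D T z → (u, v) ∈ D.arcs ∧ T.Reaches z u ∧
      T.Reaches x v ∧ x ≠ v ∧ s ∈ brSucc T ∧ (x, s) ∈ D.arcs ∧ ¬ T.Reaches s v ∧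
      Relation.ReflTransGen (avoidAnc D T v) s u := by
    intro v
    by_cases hv : v ∈ backHeads D T z
    · obtain ⟨-, hvz, hne, u, huv, hzu⟩ := (hbh v).1 hv
      obtain ⟨x, s, h⟩ := exists_detour hwf hnouseless hT hopt huv (hvz.trans hzu) (by
        rintro rfl
        exact hne (hOT.reaches_antisymm hvz hzu))
      exact ⟨u, x, s, fun _ => ⟨huv, hzu, h⟩⟩
    · exact ⟨v, v, v, fun h => absurd h hv⟩
  choose u x s hdet using hdet
  have hleaf : ∀ F : Finset V, F ⊆ D.verts → (∀ f ∈ F,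
      Relation.ReflTransGen (fun a b => (a, b) ∈ D.arcs ∧ a ∉ F) r f) → F.card ≤ n := by
    intro F hF h
    obtain ⟨T', hT', hle⟩ := exists_outBranching_card_le_leaves hwf hr hreach hF h
    exact hle.trans (hn T' hT')
  by_contra! hcon
  obtain ⟨t, -, ht⟩ := Finset.exists_lt_card_fiber_of_mul_lt_card_of_maps_to
    (f := s) (t := brSucc T) (fun v hv => (hdet v hv).2.2.2.2.1) hcon
  set C := (backHeads D T z).filter fun v => s v = t
  have hCmem : ∀ {v}, v ∈ C → v ∈ backHeads D T z ∧ s v = t := fun h => Finset.mem_filter.1 h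
  -- The common start `t` of the detours is reachable without meeting the given heads.
  have hstart : ∀ F : Finset V, F ⊆ C → F.Nonempty →
      Relation.ReflTransGen (fun a b => (a, b) ∈ D.arcs ∧ a ∉ F) r t := by
    intro F hF hne
    obtain ⟨v, hv, hmin⟩ := Finset.exists_min_image F T.depth hne
    obtain ⟨hvB, hst⟩ := hCmem (hF hv)
    obtain ⟨-, -, hxv, hxne, -, hxs, -⟩ := hdet v hvB
    have hvT : v ∈ T.verts := by rw [hT.2.1]; exact ((hbh v).1 hvB).1
    have hnot : ∀ y, T.Reaches y (x v) → y ∉ F := by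
      intro y hy hyF
      have h1 := hmin y hyF
      have h2 := IsOutTree.depth_mono hy
      have h3 := hOT.depth_lt hvT hxv hxne
      omega
    have hrx := hOT.2.2.2.2 (x v) (hOT.mem_left hxv hvT)
    rw [hst] at hxs
    refine (reflTransGen_mono_between hrx fun c d _ hcd hd => ?_).tail
      ⟨hxs, hnot _ .refl⟩
    exact ⟨hTD hcd, hnot c (hd.head hcd)⟩
  let returns : V → Prop := fun v => ∃ y, T.Reaches y z ∧ ¬ T.Reaches y v ∧
    Relation.ReflTransGen (avoidAnc D T v) t y
  have hsplit := Finset.card_filter_add_card_filter_not (s := C) returns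
  have hA : (C.filter returns).card ≤ n := by
    set F := C.filter returns
    have hFC : F ⊆ C := Finset.filter_subset _ _
    obtain hemp | hne := F.eq_empty_or_nonempty
    · simp [hemp]
    refine hleaf F (fun v hv => ((hbh v).1 (hCmem (hFC hv)).1).1) fun f hf => ?_
    obtain ⟨w, hw, hmax⟩ := Finset.exists_max_image F T.depth hne
    have hanc : ∀ v ∈ F, T.Reaches v w := by
      intro v hv
      have hvB := (hbh v).1 (hCmem (hFC hv)).1
      have hwB := (hbh w).1 (hCmem (hFC hw)).1
      obtain h | h := hOT.reaches_total hvB.2.1 hwB.2.1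
      · exact h
      · by_cases hwv : w = v
        · subst hwv; exact .refl
        · have h1 := hOT.depth_lt (by rw [hT.2.1]; exact hvB.1) h hwv
          have h2 := hmax v hv
          omega
    obtain ⟨y, hyz, hyw, hty⟩ := (Finset.mem_filter.1 hw).2
    obtain ⟨huf, hzu, -⟩ := hdet f (hCmem (hFC hf)).1
    have hty' : Relation.ReflTransGen (fun a b => (a, b) ∈ D.arcs ∧ a ∉ F) t y :=
      reflTransGen_mono_between hty fun a b _ h _ => ⟨h.1, fun ha => h.2.1 (hanc a ha)⟩
    have hnot : ∀ c, T.Reaches y c → c ∉ F := fun c hyc hc => hyw (hyc.trans (hanc c hc))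
    have hyu : T.Reaches y (u f) := hyz.trans hzu
    have hyu' := reflTransGen_mono_between
      (R' := fun a b => (a, b) ∈ D.arcs ∧ a ∉ F) hyu
      fun c d hyc hcd _ => ⟨hTD hcd, hnot c hyc⟩
    exact (((hstart F hFC hne).trans hty').trans hyu').tail ⟨huf, hnot _ hyu⟩
  have hB : (C.filter fun v => ¬ returns v).card ≤ n := by
    set F := C.filter fun v => ¬ returns v
    have hFC : F ⊆ C := Finset.filter_subset _ _
    refine hleaf F (fun v hv => ((hbh v).1 (hCmem (hFC hv)).1).1) fun f hf => ?_
    obtain ⟨hfB, hsf⟩ := hCmem (hFC hf)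
    obtain ⟨huf, hzu, -, -, -, -, hs, hsu⟩ := hdet f hfB
    rw [hsf] at hs hsu
    have hnr : ¬ returns f := (Finset.mem_filter.1 hf).2
    have hnot : ∀ c, Relation.ReflTransGen (avoidAnc D T f) t c → c ∉ F := by
      intro c htc hc
      refine hnr ⟨c, ((hbh c).1 (hCmem (hFC hc)).1).2.1, ?_, htc⟩
      obtain rfl | ⟨d, -, hd⟩ := Relation.ReflTransGen.cases_tail htc
      · exact hs
      · exact hd.2.2
    have htu := reflTransGen_mono_between (R' := fun a b => (a, b) ∈ D.arcs ∧ a ∉ F) hsu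
      fun c d htc hcd _ => ⟨hcd.1, hnot c htc⟩
    exact ((hstart F hFC ⟨f, hf⟩).trans htu).tail ⟨huf, hnot _ hsu⟩
  omega

open Classical in
/-- The bag at depth `j`: all leaves, all children of branch vertices, and the vertices whose
tree arcs or backward arcs span depth `j`. -/
noncomputable def levelBag (D T : Dgraph V) (j : ℕ) : Finset V :=
  leaves T ∪ brSucc T ∪ D.verts.filter fun v => T.depth v ≤ j ∧
    ∃ u ∈ D.verts, j ≤ T.depth u ∧ T.Reaches v u ∧ (u = v ∨ (u, v) ∈ D.arcs ∨ (v, u) ∈ T.arcs)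

open Classical in
/-- The vertices of `T` at depth `j`. -/
noncomputable def level (T : Dgraph V) (j : ℕ) : Finset V :=
  T.verts.filter fun v => T.depth v = j

theorem IsOutTree.card_level_le {T : Dgraph V} {r : V} (hT : IsOutTree T r) (j : ℕ) :
    (level T j).card ≤ (leaves T).card := by
  refine hT.card_antichain_le (Finset.filter_subset _ _) fun a ha b hb hab => ?_
  by_contra hne
  have ha := (Finset.mem_filter.1 ha).2
  obtain ⟨hbT, hb⟩ := Finset.mem_filter.1 hb
  have := hT.depth_lt hbT hab hne
  omega

theorem card_levelBag_le {D T : Dgraph V} {r : V} {n h : ℕ} (hT : IsOutBranching D T r)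
    (hn : (leaves T).card ≤ n) (hback : ∀ z, (backHeads D T z).card ≤ h) {j : ℕ}
    (hj : 1 ≤ j) : (levelBag D T j).card ≤ 5 * n + n * h := by
  classical
  have hOT := hT.2.2
  have hpred : ∀ v, ∃ p, ∀ a, (a, v) ∈ T.arcs → a = p := by
    intro v
    by_cases hv : ∃ p, (p, v) ∈ T.arcs
    · obtain ⟨p, hp⟩ := hv
      exact ⟨p, fun a ha => hOT.parent_unique ha hp⟩
    · exact ⟨v, fun a ha => absurd ⟨a, ha⟩ hv⟩
  choose p hp using hpred
  have hsub : levelBag D T j ⊆ leaves T ∪ brSucc T ∪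
      (level T j ∪ (level T j).image p ∪ (level T j).biUnion (backHeads D T)) := by
    refine Finset.union_subset_union subset_rfl fun v hv => ?_
    obtain ⟨hvD, hvj, u, huD, hju, hvu, hor⟩ := Finset.mem_filter.1 hv
    have hvT : v ∈ T.verts := hT.2.1 ▸ hvD
    have huT : u ∈ T.verts := hT.2.1 ▸ huD
    simp only [Finset.mem_union, Finset.mem_image, Finset.mem_biUnion]
    by_cases hvj' : T.depth v = j
    · exact .inl (.inl (Finset.mem_filter.2 ⟨hvT, hvj'⟩))
    obtain rfl | huv | hvu' := hor
    · omega
    · obtain ⟨z, hz, hzu, hzj⟩ := hOT.exists_ancestor_depth_eq huT hj hju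
      refine .inr ⟨z, Finset.mem_filter.2 ⟨hz, hzj⟩, Finset.mem_filter.2 ⟨hvD, ?_, ?_, u, huv, hzu⟩⟩
      · obtain h | h := hOT.reaches_total hvu hzu
        · exact h
        · have := IsOutTree.depth_mono h
          omega
      · rintro rfl
        exact hvj' hzj
    · have := hOT.depth_child hvu'
      exact .inl (.inr ⟨u, Finset.mem_filter.2 ⟨huT, by omega⟩, (hp u v hvu').symm⟩)
  have hlev := (hOT.card_level_le j).trans hn
  have hbr := hOT.card_brSucc_le
  have himg := Finset.card_image_le (s := level T j) (f := p)
  have hbi := Finset.card_biUnion_le_card_mul (level T j) (backHeads D T) h fun z _ => hback z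
  have hmul := Nat.mul_le_mul_right h hlev
  have h0 := Finset.card_le_card hsub
  have h1 := Finset.card_union_le (leaves T ∪ brSucc T)
    (level T j ∪ (level T j).image p ∪ (level T j).biUnion (backHeads D T))
  have h2 := Finset.card_union_le (leaves T) (brSucc T)
  have h3 := Finset.card_union_le (level T j ∪ (level T j).image p)
    ((level T j).biUnion (backHeads D T))
  have h4 := Finset.card_union_le (level T j) ((level T j).image p)
  omega

/-- Let `D` be a finite digraph without useless arcs for `r`, and
let `T` be a 1-optimal out-branching of `D` rooted at `r` with
`|Leaf(T)| ≤ k−1`. Then either `D` has an out-branching with at least `k`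
leaves, or the underlying undirected graph of `D` admits a path decomposition
of width at most `6k³`. -/
theorem leafy_outBranching_or_pathDecomposition {V : Type*} [DecidableEq V]
    (D T : Dgraph V) (r : V) (k : ℕ) (hk : 1 ≤ k) (hwf : DgraphWF D)
    (hr : r ∈ D.verts) (hreach : ∀ x ∈ D.verts, D.Reaches r x)
    (hnouseless : ∀ a ∈ D.arcs, ∃ T' : Dgraph V, IsOutBranching D T' r ∧ a ∈ T'.arcs)
    (hT : IsOutBranching D T r) (hopt : OneOptimal D T r)
    (hleaves : (leaves T).card ≤ k - 1) :
    (∃ (T' : Dgraph V) (r' : V), IsOutBranching D T' r' ∧ k ≤ (leaves T').card) ∨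
    (∃ (m : ℕ) (X : ℕ → Finset V),
      (∀ i, 1 ≤ i → i ≤ m → X i ⊆ D.verts) ∧
      (∀ v ∈ D.verts, ∃ i, 1 ≤ i ∧ i ≤ m ∧ v ∈ X i) ∧
      (∀ a ∈ D.arcs, ∃ i, 1 ≤ i ∧ i ≤ m ∧ a.1 ∈ X i ∧ a.2 ∈ X i) ∧
      (∀ v i j l, 1 ≤ i → i ≤ j → j ≤ l → l ≤ m →
        v ∈ X i → v ∈ X l → v ∈ X j) ∧
      (∀ i, 1 ≤ i → i ≤ m → (X i).card ≤ 6 * k ^ 3 + 1)) := by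
  classical
  by_cases hbig : ∃ (T' : Dgraph V) (r' : V), IsOutBranching D T' r' ∧ k ≤ (leaves T').card
  · exact .inl hbig
  right
  have hOT := hT.2.2
  have hn : ∀ T', IsOutBranching D T' r → (leaves T').card ≤ k - 1 := by
    intro T' hT'
    by_contra hlt
    exact hbig ⟨T', r, hT', by omega⟩
  have hself : ∀ v ∈ D.verts, v ∈ levelBag D T (T.depth v) := fun v hv =>
    Finset.mem_union_right _ (Finset.mem_filter.2
      ⟨hv, le_rfl, v, hv, le_rfl, .refl, .inl rfl⟩)
  have hone : ∀ v ∈ D.verts, 1 ≤ T.depth v := fun v hv =>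
    IsOutTree.one_le_depth (hT.2.1 ▸ hv)
  have hub : ∀ v, T.depth v ≤ T.verts.card := IsOutTree.depth_le T
  refine ⟨T.verts.card, levelBag D T, ?_, ?_, ?_, ?_, ?_⟩
  · intro i _ _ v hv
    obtain hv | hv := Finset.mem_union.1 hv
    · rw [← hT.2.1]
      obtain hv | hv := Finset.mem_union.1 hv <;> exact (Finset.mem_filter.1 hv).1
    · exact (Finset.mem_filter.1 hv).1
  · exact fun v hv => ⟨T.depth v, hone v hv, hub v, hself v hv⟩
  · rintro ⟨a, b⟩ hab
    obtain ⟨ha, hb⟩ := hwf _ hab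
    by_cases habT : (a, b) ∈ T.arcs
    · refine ⟨T.depth b, hone b hb, hub b, ?_, hself b hb⟩
      have := hOT.depth_child habT
      exact Finset.mem_union_right _ (Finset.mem_filter.2
        ⟨ha, by simp only; omega, b, hb, le_rfl, .single habT, .inr (.inr habT)⟩)
    · obtain h | h | h := hopt.arc_cases hwf hT hab habT
      · exact ⟨T.depth a, hone a ha, hub a, hself a ha,
          Finset.mem_union_right _ (Finset.mem_filter.2
            ⟨hb, IsOutTree.depth_mono h, a, ha, le_rfl, h, .inr (.inl hab)⟩)⟩
      · exact ⟨T.depth b, hone b hb, hub b,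
          Finset.mem_union_left _ (Finset.mem_union_left _ h), hself b hb⟩
      · exact ⟨T.depth a, hone a ha, hub a, hself a ha,
          Finset.mem_union_left _ (Finset.mem_union_right _ h)⟩
  · intro v i j l _ hij hjl _ hi hl
    obtain hi | hi := Finset.mem_union.1 hi
    · exact Finset.mem_union_left _ hi
    obtain hl | hl := Finset.mem_union.1 hl
    · exact Finset.mem_union_left _ hl
    obtain ⟨hv, hvi, -⟩ := Finset.mem_filter.1 hi
    obtain ⟨-, -, u, hu, hlu, h⟩ := Finset.mem_filter.1 hl
    exact Finset.mem_union_right _ (Finset.mem_filter.2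
      ⟨hv, hvi.trans hij, u, hu, hjl.trans hlu, h⟩)
  · intro i hi _
    have hback : ∀ z, (backHeads D T z).card ≤ 2 * (k - 1) * (2 * (k - 1)) := fun z =>
      (card_backHeads_le hwf hr hreach hnouseless hT hopt hn z).trans
        (Nat.mul_le_mul_right _ (hOT.card_brSucc_le.trans (Nat.mul_le_mul_left 2 hleaves)))
    refine (card_levelBag_le hT hleaves hback hi).trans ?_
    obtain ⟨n, rfl⟩ := Nat.exists_eq_add_of_le' hk
    rw [Nat.add_sub_cancel]
    nlinarith [Nat.zero_le (n ^ 3), Nat.zero_le (n ^ 2), Nat.zero_le n]
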